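/- Let Δ be the set of m ∈ ℝ⁶ with m₁ ≥ m₂ ≥ ⋯ ≥ m₆ > 0, mᵢ < 1/3 for all i, ∑ᵢ mᵢ = 1, and ∑_{k∈K} m_k ≠ 1/3 for every subset K ⊆ {1,…,6} of cardinality 2 or 3. For m ∈ Δ set S(m) = { K ⊆ {1,…,6} : |K| ∈ {2,3} and ∑_{k∈K} m_k < 1/3 }. Then the image of the map m ↦ S(m) on Δ has exactly 38 elements. -/

import Mathlib

/-- The set of admissible polarizations for `(ℙ²)⁶`: decreasing positive weights,
each below `1/3`, summing to `1`, with no subset of cardinality `2` or `3`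
whose weight sum is exactly `1/3`. -/
def Delta6 : Set (Fin 6 → ℝ) :=
  {m | (∀ i j : Fin 6, i ≤ j → m j ≤ m i) ∧ (∀ i, 0 < m i) ∧ (∀ i, m i < 1/3) ∧
    (∑ i, m i = 1) ∧
    (∀ K : Finset (Fin 6), K.card = 2 ∨ K.card = 3 → ∑ k ∈ K, m k ≠ 1/3)}

/-- The family of index sets of size `2` or `3` whose weight sum is below `1/3`. -/
def S6 (m : Fin 6 → ℝ) : Set (Finset (Fin 6)) :=
  {K | (K.card = 2 ∨ K.card = 3) ∧ ∑ k ∈ K, m k < 1/3}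

open Finset

/-- Integer weights, one vector for each chamber of `Delta6`. -/
def chamberWeights : Finset (Fin 6 → ℕ) :=
  {![2, 1, 1, 1, 1, 1], ![2, 2, 1, 1, 1, 1], ![2, 2, 2, 2, 1, 1],
   ![3, 2, 2, 1, 1, 1], ![3, 3, 1, 1, 1, 1], ![2, 2, 2, 2, 2, 1],
   ![3, 2, 2, 2, 1, 1], ![3, 3, 2, 1, 1, 1], ![3, 3, 2, 2, 2, 1],
   ![3, 3, 3, 2, 1, 1], ![4, 3, 2, 2, 1, 1], ![3, 3, 3, 2, 2, 1],
   ![4, 3, 2, 2, 2, 1], ![4, 3, 3, 2, 1, 1], ![4, 4, 2, 2, 1, 1],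
   ![4, 3, 3, 2, 2, 2], ![4, 3, 3, 3, 2, 1], ![4, 4, 3, 2, 2, 1],
   ![4, 4, 3, 3, 1, 1], ![5, 3, 3, 3, 1, 1], ![5, 4, 2, 2, 2, 1],
   ![4, 4, 3, 3, 2, 1], ![4, 4, 4, 2, 2, 1], ![5, 4, 3, 2, 2, 1],
   ![5, 4, 3, 3, 1, 1], ![5, 5, 2, 2, 2, 1], ![5, 4, 3, 3, 2, 2],
   ![5, 4, 4, 3, 2, 1], ![5, 4, 4, 4, 1, 1], ![5, 5, 3, 3, 2, 1],
   ![5, 5, 4, 3, 2, 1], ![6, 5, 3, 3, 2, 1], ![5, 5, 5, 5, 1, 1],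
   ![6, 5, 4, 3, 2, 2], ![6, 5, 4, 4, 2, 1], ![6, 6, 3, 3, 3, 1],
   ![6, 6, 4, 4, 2, 1], ![7, 5, 5, 5, 2, 1]}

/-- The index sets of size `2` or `3` that are light for some but not all points of `Delta6`. -/
def criticalSets : Finset (Finset (Fin 6)) :=
  {{0, 4}, {0, 5}, {1, 2}, {1, 3}, {1, 4}, {1, 5}, {2, 3}, {2, 4}, {3, 4},
   {0, 4, 5}, {1, 4, 5}, {2, 3, 4}, {2, 3, 5}, {2, 4, 5}, {3, 4, 5}}

/-- The index sets of size `2` or `3` that are light for every point of `Delta6`. -/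
def lightSets : Finset (Finset (Fin 6)) :=
  {{2, 5}, {3, 5}, {4, 5}}

/-- The index sets of size `2` or `3` that are light for no point of `Delta6`. -/
def heavySets : Finset (Finset (Fin 6)) :=
  {{0, 1}, {0, 2}, {0, 3}, {0, 1, 2}, {0, 1, 3}, {0, 1, 4}, {0, 1, 5}, {0, 2, 3}, {0, 2, 4},
   {0, 2, 5}, {0, 3, 4}, {0, 3, 5}, {1, 2, 3}, {1, 2, 4}, {1, 2, 5}, {1, 3, 4}, {1, 3, 5}}

/-- `K` carries less than one third of the total weight of `w`. -/
def IsLight (w : Fin 6 → ℕ) (K : Finset (Fin 6)) : Prop :=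
  3 * ∑ k ∈ K, w k < ∑ i, w i

instance (w : Fin 6 → ℕ) (K : Finset (Fin 6)) : Decidable (IsLight w K) :=
  inferInstanceAs (Decidable (_ < _))

/-- The weight vector `w` rescaled to total weight `1`. -/
noncomputable def normalizedWeight (w : Fin 6 → ℕ) (i : Fin 6) : ℝ :=
  w i / (∑ j, w j : ℕ)

lemma sum_normalizedWeight (w : Fin 6 → ℕ) (K : Finset (Fin 6)) :
    ∑ k ∈ K, normalizedWeight w k = (∑ k ∈ K, w k : ℕ) / (∑ j, w j : ℕ) := by
  simp [normalizedWeight, Finset.sum_div]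

lemma sum_normalizedWeight_lt_iff {w : Fin 6 → ℕ} (hw : 0 < ∑ i, w i) (K : Finset (Fin 6)) :
    ∑ k ∈ K, normalizedWeight w k < 1 / 3 ↔ IsLight w K := by
  have hw' : (0 : ℝ) < (∑ i, w i : ℕ) := by exact_mod_cast hw
  rw [sum_normalizedWeight, div_lt_div_iff₀ hw' three_pos, IsLight, ← Nat.cast_lt (α := ℝ)]
  push_cast
  rw [one_mul, mul_comm]

lemma sum_normalizedWeight_eq_iff {w : Fin 6 → ℕ} (hw : 0 < ∑ i, w i) (K : Finset (Fin 6)) :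
    ∑ k ∈ K, normalizedWeight w k = 1 / 3 ↔ 3 * ∑ k ∈ K, w k = ∑ i, w i := by
  have hw' : (0 : ℝ) < (∑ i, w i : ℕ) := by exact_mod_cast hw
  rw [sum_normalizedWeight, div_eq_div_iff hw'.ne' three_ne_zero, ← Nat.cast_inj (R := ℝ)]
  push_cast
  rw [one_mul, mul_comm]

lemma normalizedWeight_mem_Delta6 {w : Fin 6 → ℕ} (hanti : ∀ i j : Fin 6, i ≤ j → w j ≤ w i)
    (hpos : ∀ i, 0 < w i) (hlight : ∀ i, IsLight w {i})
    (hne : ∀ K : Finset (Fin 6), K.card = 2 ∨ K.card = 3 → 3 * ∑ k ∈ K, w k ≠ ∑ i, w i) :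
    normalizedWeight w ∈ Delta6 := by
  have hw : 0 < ∑ i, w i := Finset.sum_pos (fun i _ => hpos i) univ_nonempty
  have hw' : (0 : ℝ) < (∑ i, w i : ℕ) := by exact_mod_cast hw
  refine ⟨fun i j hij => ?_, fun i => ?_, fun i => ?_, ?_, fun K hK => ?_⟩
  · exact div_le_div_of_nonneg_right (by exact_mod_cast hanti i j hij) hw'.le
  · exact div_pos (by exact_mod_cast hpos i) hw'
  · simpa using (sum_normalizedWeight_lt_iff hw {i}).2 (hlight i)
  · rw [sum_normalizedWeight, div_self hw'.ne']
  · exact fun h => hne K hK ((sum_normalizedWeight_eq_iff hw K).1 h)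

lemma sum_pos_of_mem_chamberWeights : ∀ w ∈ chamberWeights, 0 < ∑ i, w i := by
  decide +kernel

lemma normalizedWeight_mem_Delta6_of_mem_chamberWeights {w : Fin 6 → ℕ}
    (hw : w ∈ chamberWeights) : normalizedWeight w ∈ Delta6 := by
  have key : ∀ w ∈ chamberWeights, (∀ i j : Fin 6, i ≤ j → w j ≤ w i) ∧ (∀ i, 0 < w i) ∧
      (∀ i, IsLight w {i}) ∧ ∀ K : Finset (Fin 6), K.card = 2 ∨ K.card = 3 →
        3 * ∑ k ∈ K, w k ≠ ∑ i, w i := by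
    decide +kernel
  obtain ⟨hanti, hpos, hlight, hne⟩ := key w hw
  exact normalizedWeight_mem_Delta6 hanti hpos hlight hne

/-- Distinct chamber weights are separated by the critical sets. -/
lemma eq_of_isLight_iff : ∀ w ∈ chamberWeights, ∀ w' ∈ chamberWeights,
    (∀ K ∈ criticalSets, (IsLight w K ↔ IsLight w' K)) → w = w' := by
  decide +kernel

lemma card_of_mem_criticalSets : ∀ K ∈ criticalSets, K.card = 2 ∨ K.card = 3 := by
  decide +kernel

lemma injOn_S6_normalizedWeight :
    Set.InjOn (fun w => S6 (normalizedWeight w)) (chamberWeights : Set (Fin 6 → ℕ)) := by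
  intro w hw w' hw' h
  refine eq_of_isLight_iff w hw w' hw' fun K hK => ?_
  have hcard := card_of_mem_criticalSets K hK
  have hmem : K ∈ S6 (normalizedWeight w) ↔ K ∈ S6 (normalizedWeight w') :=
    iff_of_eq (congrArg (K ∈ ·) h)
  simpa only [S6, Set.mem_ofPred_eq, hcard, true_and,
    sum_normalizedWeight_lt_iff (sum_pos_of_mem_chamberWeights w hw),
    sum_normalizedWeight_lt_iff (sum_pos_of_mem_chamberWeights w' hw')] using hmem

lemma mem_criticalSets_or_mem_of_card : ∀ K : Finset (Fin 6), K.card = 2 ∨ K.card = 3 →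
    K ∈ criticalSets ∨ K ∈ lightSets ∨ K ∈ heavySets := by
  decide +kernel

/-- The linear relations defining `Delta6`, written out in coordinates. -/
lemma coordinates_of_mem_Delta6 {m : Fin 6 → ℝ} (hm : m ∈ Delta6) :
    (m 1 ≤ m 0 ∧ m 2 ≤ m 1 ∧ m 3 ≤ m 2 ∧ m 4 ≤ m 3 ∧ m 5 ≤ m 4) ∧ 0 < m 5 ∧ m 0 < 1 / 3 ∧
      m 0 + m 1 + m 2 + m 3 + m 4 + m 5 = 1 := by
  obtain ⟨hanti, hpos, hlt, hsum, -⟩ := hm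
  rw [Fin.sum_univ_six] at hsum
  exact ⟨⟨hanti 0 1 (by decide), hanti 1 2 (by decide), hanti 2 3 (by decide),
    hanti 3 4 (by decide), hanti 4 5 (by decide)⟩, hpos 5, hlt 0, hsum⟩

lemma sum_lt_of_mem_Delta6 {m : Fin 6 → ℝ} (hm : m ∈ Delta6) {K : Finset (Fin 6)}
    (hK : K ∈ lightSets) : ∑ k ∈ K, m k < 1 / 3 := by
  have hne := hm.2.2.2.2 {2, 5} (Or.inl (by decide))
  obtain ⟨⟨h01, h12, h23, h34, h45⟩, -, hlt, hsum⟩ := coordinates_of_mem_Delta6 hm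
  rw [sum_pair (by decide)] at hne
  have h25 : m 2 + m 5 < 1 / 3 := lt_of_le_of_ne (by linarith) hne
  simp only [lightSets, mem_insert, mem_singleton] at hK
  rcases hK with rfl | rfl | rfl <;> rw [sum_pair (by decide)] <;> linarith

lemma not_sum_lt_of_mem_Delta6 {m : Fin 6 → ℝ} (hm : m ∈ Delta6) {K : Finset (Fin 6)}
    (hK : K ∈ heavySets) : ¬ ∑ k ∈ K, m k < 1 / 3 := by
  obtain ⟨⟨h01, h12, h23, h34, h45⟩, hpos, hlt, hsum⟩ := coordinates_of_mem_Delta6 hm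
  simp only [heavySets, mem_insert, mem_singleton] at hK
  rcases hK with rfl | rfl | rfl | rfl | rfl | rfl | rfl | rfl | rfl | rfl | rfl | rfl | rfl |
    rfl | rfl | rfl | rfl <;> simp <;> linarith

/-- On `Delta6`, the family `S6 m` is determined by its trace on the critical sets. -/
lemma S6_eq_of_forall_criticalSets {m m' : Fin 6 → ℝ} (hm : m ∈ Delta6) (hm' : m' ∈ Delta6)
    (h : ∀ K ∈ criticalSets, (∑ k ∈ K, m k < 1 / 3 ↔ ∑ k ∈ K, m' k < 1 / 3)) :
    S6 m = S6 m' := by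
  ext K
  refine and_congr_right fun hK => ?_
  rcases mem_criticalSets_or_mem_of_card K hK with hK | hK | hK
  · exact h K hK
  · exact iff_of_true (sum_lt_of_mem_Delta6 hm hK) (sum_lt_of_mem_Delta6 hm' hK)
  · exact iff_of_false (not_sum_lt_of_mem_Delta6 hm hK) (not_sum_lt_of_mem_Delta6 hm' hK)

set_option synthInstance.maxSize 1000 in
/-- Every Boolean pattern on the critical sets that is monotone for the dominance order and
compatible with the partitions of `Fin 6` into pairs or triples is realized by a chamber weight. -/
lemma exists_chamberWeight_of_pattern :
    ∀ b05 b14 b23 : Bool, ¬ (b05 ∧ b14 ∧ b23) → (b05 ∨ b14 ∨ b23) →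
    ∀ b04 : Bool, (b04 → b05) → (b04 → b14) →
    ∀ b13 : Bool, (b13 → b14) → (b13 → b23) →
    ∀ b12 : Bool, (b12 → b13) →
    ∀ b15 : Bool, (b05 → b15) → (b14 → b15) →
    ∀ b24 : Bool, (b14 → b24) → (b23 → b24) →
    ∀ b34 : Bool, (b24 → b34) →
    ∀ b345 : Bool, (b345 → b34) → (b345 → ¬ b12) →
    ∀ b245 : Bool, (b245 → b345) → (b245 → b24) → (b245 → ¬ b13) →
    ∀ b145 : Bool, (b145 → b245) → (b145 → b14) → (b145 → ¬ b23) →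
    ∀ b045 : Bool, (b045 → b145) → (b045 → b04) →
    ∀ b235 : Bool, (b235 → b245) → (b235 → b23) → (b235 → ¬ b14) →
    ∀ b234 : Bool, (b234 → b235) → (b234 → ¬ b15) →
    ∃ w ∈ chamberWeights,
      [decide (IsLight w {0, 4}), decide (IsLight w {0, 5}), decide (IsLight w {1, 2}),
       decide (IsLight w {1, 3}), decide (IsLight w {1, 4}), decide (IsLight w {1, 5}),
       decide (IsLight w {2, 3}), decide (IsLight w {2, 4}), decide (IsLight w {3, 4}),
       decide (IsLight w {0, 4, 5}), decide (IsLight w {1, 4, 5}), decide (IsLight w {2, 3, 4}),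
       decide (IsLight w {2, 3, 5}), decide (IsLight w {2, 4, 5}), decide (IsLight w {3, 4, 5})] =
      [b04, b05, b12, b13, b14, b15, b23, b24, b34, b045, b145, b234, b235, b245, b345] := by
  decide +kernel

lemma exists_chamberWeight_forall_criticalSets {m : Fin 6 → ℝ} (hm : m ∈ Delta6) :
    ∃ w ∈ chamberWeights, ∀ K ∈ criticalSets, (IsLight w K ↔ ∑ k ∈ K, m k < 1 / 3) := by
  obtain ⟨⟨h01, h12, h23, h34, h45⟩, hpos, hlt, hsum⟩ := coordinates_of_mem_Delta6 hm
  have hpartition : m 0 + m 5 < 1 / 3 ∨ m 1 + m 4 < 1 / 3 ∨ m 2 + m 3 < 1 / 3 := by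
    have hne := hm.2.2.2.2 {0, 5} (Or.inl (by decide))
    rw [sum_pair (by decide)] at hne
    by_contra! h
    exact hne (by linarith)
  refine (exists_chamberWeight_of_pattern
    (decide (m 0 + m 5 < 1 / 3)) (decide (m 1 + m 4 < 1 / 3)) (decide (m 2 + m 3 < 1 / 3))
    ?_ (by simpa only [decide_eq_true_eq] using hpartition)
    (decide (m 0 + m 4 < 1 / 3)) ?_ ?_
    (decide (m 1 + m 3 < 1 / 3)) ?_ ?_
    (decide (m 1 + m 2 < 1 / 3)) ?_
    (decide (m 1 + m 5 < 1 / 3)) ?_ ?_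
    (decide (m 2 + m 4 < 1 / 3)) ?_ ?_
    (decide (m 3 + m 4 < 1 / 3)) ?_
    (decide (m 3 + m 4 + m 5 < 1 / 3)) ?_ ?_
    (decide (m 2 + m 4 + m 5 < 1 / 3)) ?_ ?_ ?_
    (decide (m 1 + m 4 + m 5 < 1 / 3)) ?_ ?_ ?_
    (decide (m 0 + m 4 + m 5 < 1 / 3)) ?_ ?_
    (decide (m 2 + m 3 + m 5 < 1 / 3)) ?_ ?_ ?_
    (decide (m 2 + m 3 + m 4 < 1 / 3)) ?_ ?_).imp
    fun w hw => ⟨hw.1, ?traces⟩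
  case traces =>
    intro K hK
    simp only [List.cons.injEq, decide_eq_decide] at hw
    simp only [criticalSets, mem_insert, mem_singleton] at hK
    rcases hK with rfl | rfl | rfl | rfl | rfl | rfl | rfl | rfl | rfl | rfl | rfl | rfl | rfl |
      rfl | rfl <;> simp [hw, add_assoc]
  · simp only [decide_eq_true_eq]
    rintro ⟨h₁, h₂, h₃⟩
    linarith
  all_goals
    simp only [decide_eq_true_eq]
    intros
    linarith

lemma image_S6_Delta6 :
    S6 '' Delta6 = (fun w => S6 (normalizedWeight w)) '' (chamberWeights : Set (Fin 6 → ℕ)) := by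
  refine Set.Subset.antisymm ?_ ?_
  · rintro _ ⟨m, hm, rfl⟩
    obtain ⟨w, hw, h⟩ := exists_chamberWeight_forall_criticalSets hm
    refine ⟨w, hw, S6_eq_of_forall_criticalSets
      (normalizedWeight_mem_Delta6_of_mem_chamberWeights hw) hm fun K hK => ?_⟩
    rw [sum_normalizedWeight_lt_iff (sum_pos_of_mem_chamberWeights w hw), h K hK]
  · rintro _ ⟨w, hw, rfl⟩
    exact Set.mem_image_of_mem _ (normalizedWeight_mem_Delta6_of_mem_chamberWeights hw)

theorem stmt_4 : (S6 '' Delta6).ncard = 38 := by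
  rw [image_S6_Delta6, injOn_S6_normalizedWeight.ncard_image, Set.ncard_coe_finset]
  decide +kernel
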